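/- For all real numbers x_1, …, x_n, setting x := (x_3 + x_4)/2, one has f(x_1, x_2, x_3, x_4, x_5, …, x_n) ≥ f(x_1, x_2, x, x, x_5, …, x_n); that is, f does not decrease when two of the variables x_3, …, x_n are replaced by their average. -/

import Mathlib

open Finset

/-- `M x i j = x_i + x_j`. -/
noncomputable def solM (x : ℕ → ℝ) (i j : ℕ) : ℝ := x i + x j

/-- `S = Σ_{i<j, {i,j}≠{1,2}} M_{ij}`, indices running over `1,…,n`. -/
noncomputable def solS (n : ℕ) (x : ℕ → ℝ) : ℝ :=
  ∑ i ∈ Icc 1 n, ∑ j ∈ Icc 1 n,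
    if i < j ∧ ¬(i = 1 ∧ j = 2) then solM x i j else 0

/-- The function `f` from the algebra lemma. -/
noncomputable def solf (n m : ℕ) (x : ℕ → ℝ) : ℝ :=
  -(solS n x / ((m : ℝ) + 1)) * (solS n x + ((m : ℝ) + 1) * solM x 1 2)
    - solM x 1 2 * solS n x
    + ((∑ i ∈ Icc 1 n, ∑ j ∈ Icc 1 n,
        if i < j ∧ ¬(i = 1 ∧ j = 2) then
          (solM x i j) ^ 2 +
            ∑ k ∈ (Icc 1 n).filter (fun k => k ≠ i ∧ k ≠ j), solM x i k * solM x j k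
        else 0)
      + ((m : ℝ) + 1) *
          ∑ k ∈ (Icc 1 n).filter (fun k => k ≠ 1 ∧ k ≠ 2), solM x 1 k * solM x 2 k)

/-- A sum of a symmetric function over the pairs `i < j` other than `(1, 2)`. -/
theorem sum_pairs_ne_one_two (n : ℕ) (hn : 2 ≤ n) (F : ℕ → ℕ → ℝ) (hF : ∀ i j, F i j = F j i) :
    (∑ i ∈ Icc 1 n, ∑ j ∈ Icc 1 n, if i < j ∧ ¬(i = 1 ∧ j = 2) then F i j else 0) =
      ((∑ i ∈ Icc 1 n, ∑ j ∈ Icc 1 n, F i j) - ∑ i ∈ Icc 1 n, F i i) / 2 - F 1 2 := by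
  have hlt : (∑ i ∈ Icc 1 n, ∑ j ∈ Icc 1 n, if i < j ∧ ¬(i = 1 ∧ j = 2) then F i j else 0) =
      (∑ i ∈ Icc 1 n, ∑ j ∈ Icc 1 n, if i < j then F i j else 0) - F 1 2 := by
    have hone : (∑ i ∈ Icc 1 n, ∑ j ∈ Icc 1 n, if i = 1 then (if j = 2 then F i j else 0) else 0)
        = F 1 2 := by
      rw [sum_eq_single_of_mem 1 (by simp; omega) (by intro b _ hb; simp [hb]),
        sum_eq_single_of_mem 2 (by simp; omega) (by intro b _ hb; simp [hb])]
      simp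
    rw [← hone, ← sum_sub_distrib]
    refine sum_congr rfl fun i _ => ?_
    rw [← sum_sub_distrib]
    refine sum_congr rfl fun j _ => ?_
    split_ifs <;> first | omega | simp
  have hgt : (∑ i ∈ Icc 1 n, ∑ j ∈ Icc 1 n, if j < i then F i j else 0) =
      ∑ i ∈ Icc 1 n, ∑ j ∈ Icc 1 n, if i < j then F i j else 0 := by
    rw [sum_comm]
    simp only [hF]
  have hdiag : (∑ i ∈ Icc 1 n, ∑ j ∈ Icc 1 n, if i = j then F i j else 0) =
      ∑ i ∈ Icc 1 n, F i i := by
    refine sum_congr rfl fun i hi => ?_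
    rw [sum_ite_eq, if_pos hi]
  have hall : (∑ i ∈ Icc 1 n, ∑ j ∈ Icc 1 n, F i j) =
      (∑ i ∈ Icc 1 n, ∑ j ∈ Icc 1 n, if i < j then F i j else 0) +
      (∑ i ∈ Icc 1 n, ∑ j ∈ Icc 1 n, if j < i then F i j else 0) +
      ∑ i ∈ Icc 1 n, ∑ j ∈ Icc 1 n, if i = j then F i j else 0 := by
    simp only [← sum_add_distrib]
    refine sum_congr rfl fun i _ => sum_congr rfl fun j _ => ?_
    rcases lt_trichotomy i j with h | h | h
    · simp [h, h.not_gt, h.ne]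
    · simp [h]
    · simp [h, h.not_gt, h.ne']
  linarith

theorem solS_eq (n : ℕ) (hn : 2 ≤ n) (x : ℕ → ℝ) :
    solS n x = ((n : ℝ) - 1) * ∑ i ∈ Icc 1 n, x i - (x 1 + x 2) := by
  unfold solS
  rw [sum_pairs_ne_one_two n hn (solM x) fun i j => add_comm _ _]
  simp only [solM, sum_add_distrib, sum_const, Nat.card_Icc, nsmul_eq_mul, ← mul_sum,
    add_tsub_cancel_right]
  ring

theorem sum_solM_mul_solM (n : ℕ) (x : ℕ → ℝ) {i j : ℕ} (hi : i ∈ Icc 1 n) (hj : j ∈ Icc 1 n)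
    (hij : i ≠ j) :
    ∑ k ∈ (Icc 1 n).filter (fun k => k ≠ i ∧ k ≠ j), solM x i k * solM x j k =
      n * (x i * x j) + (x i + x j) * (∑ k ∈ Icc 1 n, x k) + (∑ k ∈ Icc 1 n, x k ^ 2)
        - 2 * (x i + x j) ^ 2 := by
  have hfilter : (Icc 1 n).filter (fun k => k ≠ i ∧ k ≠ j) = ((Icc 1 n).erase i).erase j := by
    ext k
    simp only [mem_filter, mem_erase]
    tauto
  have hall : ∑ k ∈ Icc 1 n, solM x i k * solM x j k =
      n * (x i * x j) + (x i + x j) * (∑ k ∈ Icc 1 n, x k) + ∑ k ∈ Icc 1 n, x k ^ 2 := by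
    have hexpand (k : ℕ) : solM x i k * solM x j k = x i * x j + (x i + x j) * x k + x k ^ 2 := by
      unfold solM
      ring
    simp [hexpand, sum_add_distrib, ← mul_sum]
  rw [hfilter, sum_erase_eq_sub (mem_erase.2 ⟨hij.symm, hj⟩), sum_erase_eq_sub hi, hall]
  unfold solM
  ring

/-- `f` in terms of `x 1`, `x 2` and the first two power sums. -/
theorem solf_eq (n m : ℕ) (hn : 2 ≤ n) (x : ℕ → ℝ) (P Q : ℝ)
    (hP : ∑ k ∈ Icc 1 n, x k = P) (hQ : ∑ k ∈ Icc 1 n, x k ^ 2 = Q) :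
    solf n m x =
      -((((n : ℝ) - 1) * P - (x 1 + x 2)) / ((m : ℝ) + 1)) *
          (((n : ℝ) - 1) * P - (x 1 + x 2) + ((m : ℝ) + 1) * (x 1 + x 2))
        - (x 1 + x 2) * (((n : ℝ) - 1) * P - (x 1 + x 2))
        + (3 * (n : ℝ) - 4) / 2 * P ^ 2 - (x 1 + x 2) ^ 2
        + m * (n * (x 1 * x 2) + (x 1 + x 2) * P - 2 * (x 1 + x 2) ^ 2)
        + (((n : ℝ) - 2) ^ 2 / 2 + m) * Q := by
  have hpairs : (∑ i ∈ Icc 1 n, ∑ j ∈ Icc 1 n,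
        if i < j ∧ ¬(i = 1 ∧ j = 2) then
          (solM x i j) ^ 2 +
            ∑ k ∈ (Icc 1 n).filter (fun k => k ≠ i ∧ k ≠ j), solM x i k * solM x j k
        else 0) =
      ∑ i ∈ Icc 1 n, ∑ j ∈ Icc 1 n, if i < j ∧ ¬(i = 1 ∧ j = 2) then
        (n - 2) * (x i * x j) + (x i + x j) * P + Q - x i ^ 2 - x j ^ 2 else 0 := by
    refine sum_congr rfl fun i hi => sum_congr rfl fun j hj => ?_
    split_ifs with h
    · rw [sum_solM_mul_solM n x hi hj h.1.ne, hP, hQ, solM]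
      ring
    · rfl
  unfold solf
  rw [hpairs, solS_eq n hn, sum_solM_mul_solM n x (by simp; omega) (by simp; omega) (by decide),
    sum_pairs_ne_one_two n hn
      (fun i j => (n - 2) * (x i * x j) + (x i + x j) * P + Q - x i ^ 2 - x j ^ 2)
      (fun i j => by ring)]
  have hdouble : (∑ i ∈ Icc 1 n, ∑ j ∈ Icc 1 n,
      ((n - 2) * (x i * x j) + (x i + x j) * P + Q - x i ^ 2 - x j ^ 2)) =
      (n - 2) * P ^ 2 + 2 * n * P ^ 2 + n ^ 2 * Q - 2 * n * Q := by
    simp only [sum_add_distrib, sum_sub_distrib, ← mul_sum, ← sum_mul, sum_const, Nat.card_Icc,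
      nsmul_eq_mul, add_tsub_cancel_right, hP, hQ]
    ring
  have hdiag : (∑ i ∈ Icc 1 n,
      ((n - 2) * (x i * x i) + (x i + x i) * P + Q - x i ^ 2 - x i ^ 2)) =
      2 * P ^ 2 + (2 * n - 4) * Q := by
    simp only [← pow_two, sum_add_distrib, sum_sub_distrib, ← mul_sum, ← sum_mul, sum_const,
      Nat.card_Icc, nsmul_eq_mul, add_tsub_cancel_right, hP, hQ]
    ring
  rw [hdouble, hdiag, hP, hQ]
  unfold solM
  ring

theorem sum_comp_update_three_four (n : ℕ) (hn : 4 ≤ n) (x : ℕ → ℝ) (a b : ℝ) (g : ℝ → ℝ) :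
    ∑ k ∈ Icc 1 n, g (Function.update (Function.update x 3 a) 4 b k) =
      ∑ k ∈ Icc 1 n, g (x k) - g (x 3) - g (x 4) + g a + g b := by
  have h3 : 3 ∈ Icc 1 n := by simp; omega
  have h4 : 4 ∈ (Icc 1 n).erase 3 := by simp; omega
  rw [← add_sum_erase _ _ h3, ← add_sum_erase _ _ h4, ← add_sum_erase (Icc 1 n) _ h3,
    ← add_sum_erase _ (fun k => g (x k)) h4]
  have hrest : ∑ k ∈ ((Icc 1 n).erase 3).erase 4,
      g (Function.update (Function.update x 3 a) 4 b k) =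
      ∑ k ∈ ((Icc 1 n).erase 3).erase 4, g (x k) := by
    refine sum_congr rfl fun k hk => ?_
    simp only [mem_erase] at hk
    simp [hk.1, hk.2.1]
  rw [hrest]
  simp
  ring

/-- Replacing `x_3` and `x_4` by their average does not decrease `f`. -/
theorem averaging_claim (n m : ℕ) (hn : 4 ≤ n) (hm : 1 ≤ m) (x : ℕ → ℝ) :
    solf n m x ≥
      solf n m
        (Function.update (Function.update x 3 ((x 3 + x 4) / 2)) 4 ((x 3 + x 4) / 2)) := by
  have hP := sum_comp_update_three_four n hn x ((x 3 + x 4) / 2) ((x 3 + x 4) / 2) fun t => t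
  have hQ := sum_comp_update_three_four n hn x ((x 3 + x 4) / 2) ((x 3 + x 4) / 2) (· ^ 2)
  have hP' : ∑ k ∈ Icc 1 n, x k - x 3 - x 4 + (x 3 + x 4) / 2 + (x 3 + x 4) / 2 =
      ∑ k ∈ Icc 1 n, x k := by ring
  rw [solf_eq n m (by omega) x _ _ rfl rfl, solf_eq n m (by omega) _ _ _ (hP.trans hP') hQ]
  have hnonneg : 0 ≤ (((n : ℝ) - 2) ^ 2 / 2 + m) * (x 3 - x 4) ^ 2 := by positivity
  simp only [Function.update_apply]
  norm_num
  linarith
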